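/- arXiv:1808.02382 — 6 statements merged into one kernel-verified Lean document; each statement's English description precedes it below -/
import Mathlib

section
/- Let a ∈ k with a ∉ {n·1_k : n ∈ ℤ}. Then for every g ∈ k((S)) there exists a unique f ∈ k((S)) with d(f) − a·f = g, and this f satisfies |f| = |g|. Consequently d − a·id is invertible in L_k(k((S))) and its inverse is an isometry, of operator norm 1. -/
noncomputable section
open scoped Classical

/-- The operator `d = S·d/dS` on `k((S))`. -/
def dOp {k : Type*} [Field k] (f : LaurentSeries k) : LaurentSeries k :=
  ⟨fun i => (i : k) * f.coeff i,
    f.isPWO_support'.mono fun i hi => by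
      simp only [Function.mem_support, ne_eq] at hi ⊢
      intro h
      exact hi (by rw [h, mul_zero])⟩

/-- The `S`-adic absolute value on `k((S))` with `|S| = r` (and `k` trivially valued). -/
def lnorm {k : Type*} [Field k] (r : ℝ) (f : LaurentSeries k) : ℝ :=
  if f = 0 then 0 else r ^ f.order

/-- The operator norm `‖φ‖ = sup_{f ≠ 0} |φ f| / |f|` of an operator on `k((S))`. -/
def opNorm {k : Type*} [Field k] (r : ℝ) (φ : LaurentSeries k → LaurentSeries k) : ℝ :=
  sSup {x : ℝ | ∃ f : LaurentSeries k, f ≠ 0 ∧ x = lnorm r (φ f) / lnorm r f}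

theorem coeff_dOp_sub_smul {k : Type*} [Field k] (a : k) (f : LaurentSeries k) (i : ℤ) :
    (dOp f - a • f).coeff i = ((i : k) - a) * f.coeff i := by
  simp [dOp, sub_mul]

/-- The absolute value of a Laurent series depends only on its support. -/
theorem lnorm_congr_support {k : Type*} [Field k] (r : ℝ) {f g : LaurentSeries k}
    (h : ∀ i, f.coeff i = 0 ↔ g.coeff i = 0) : lnorm r f = lnorm r g := by
  have h_zero : f = 0 ↔ g = 0 := by
    simp only [HahnSeries.ext_iff, funext_iff, HahnSeries.coeff_zero, h]
  by_cases hf : f = 0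
  · simp [lnorm, hf, h_zero.mp hf]
  have hg : g ≠ 0 := fun hg => hf (h_zero.mpr hg)
  have h_order : f.order = g.order := le_antisymm
    (HahnSeries.order_le_of_coeff_ne_zero
      fun hc => HahnSeries.coeff_order_eq_zero.not.mpr hg ((h _).mp hc))
    (HahnSeries.order_le_of_coeff_ne_zero
      fun hc => HahnSeries.coeff_order_eq_zero.not.mpr hf ((h _).mpr hc))
  simp [lnorm, hf, hg, h_order]

theorem lnorm_pos {k : Type*} [Field k] {r : ℝ} (hr : 0 < r) {f : LaurentSeries k}
    (hf : f ≠ 0) : 0 < lnorm r f := by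
  simpa [lnorm, hf] using zpow_pos hr f.order

theorem opNorm_eq_one_of_isometry {k : Type*} [Field k] {r : ℝ} (hr : 0 < r)
    {φ : LaurentSeries k → LaurentSeries k} (hφ : ∀ f, lnorm r (φ f) = lnorm r f) :
    opNorm r φ = 1 := by
  have h_set : {x : ℝ | ∃ f : LaurentSeries k, f ≠ 0 ∧ x = lnorm r (φ f) / lnorm r f} = {1} := by
    ext x
    constructor
    · rintro ⟨f, hf, rfl⟩
      rw [hφ, div_self (lnorm_pos hr hf).ne']
      rfl
    · rintro rfl
      exact ⟨1, one_ne_zero, by rw [hφ, div_self (lnorm_pos hr one_ne_zero).ne']⟩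
  rw [opNorm, h_set, csSup_singleton]

/-- The inverse of `d - a·id`, dividing the `i`-th coefficient by `i - a`. -/
def dOpSubSMulInv {k : Type*} [Field k] (a : k) (g : LaurentSeries k) : LaurentSeries k :=
  ⟨fun i => ((i : k) - a)⁻¹ * g.coeff i,
    g.isPWO_support'.mono fun _ hi => right_ne_zero_of_mul hi⟩

theorem coeff_dOpSubSMulInv {k : Type*} [Field k] (a : k) (g : LaurentSeries k) (i : ℤ) :
    (dOpSubSMulInv a g).coeff i = ((i : k) - a)⁻¹ * g.coeff i := rfl

/-- if `a ∈ k` is not an integer (i.e. not of the form `n·1_k`, `n ∈ ℤ`),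
then for every `g ∈ k((S))` there is a unique `f` with `d f − a f = g`, and `|f| = |g|`;
consequently `d − a·id` is invertible in `L_k(k((S)))`, its inverse being a (linear,
bounded) isometry of operator norm `1`. -/
theorem dOp_sub_smul_invertible_isometry
    {k : Type*} [Field k] [CharZero k] (r : ℝ) (hr0 : 0 < r) (hr1 : r < 1)
    (a : k) (ha : ∀ n : ℤ, a ≠ (n : k)) :
    (∀ g : LaurentSeries k, ∃! f : LaurentSeries k, dOp f - a • f = g) ∧
    (∀ f g : LaurentSeries k, dOp f - a • f = g → lnorm r f = lnorm r g) ∧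
    (∃ ψ : LaurentSeries k → LaurentSeries k, IsLinearMap k ψ ∧
      (∃ C : ℝ, ∀ f, lnorm r (ψ f) ≤ C * lnorm r f) ∧
      (∀ f, ψ (dOp f - a • f) = f) ∧
      (∀ g, dOp (ψ g) - a • ψ g = g) ∧
      (∀ g, lnorm r (ψ g) = lnorm r g) ∧
      opNorm r ψ = 1) := by
  have h_ne : ∀ i : ℤ, (i : k) - a ≠ 0 := fun i => sub_ne_zero.mpr (ha i).symm
  have h_left : ∀ f : LaurentSeries k, dOpSubSMulInv a (dOp f - a • f) = f := fun f => by
    ext i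
    rw [coeff_dOpSubSMulInv, coeff_dOp_sub_smul, inv_mul_cancel_left₀ (h_ne i)]
  have h_right : ∀ g : LaurentSeries k,
      dOp (dOpSubSMulInv a g) - a • dOpSubSMulInv a g = g := fun g => by
    ext i
    rw [coeff_dOp_sub_smul, coeff_dOpSubSMulInv, mul_inv_cancel_left₀ (h_ne i)]
  have h_norm : ∀ g : LaurentSeries k, lnorm r (dOpSubSMulInv a g) = lnorm r g := fun g =>
    lnorm_congr_support r fun i => by simp [coeff_dOpSubSMulInv, h_ne i]
  refine ⟨fun g => ⟨dOpSubSMulInv a g, h_right g, ?_⟩, ?_, dOpSubSMulInv a, ⟨?_, ?_⟩,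
    ⟨1, fun f => by rw [h_norm, one_mul]⟩, h_left, h_right, h_norm,
    opNorm_eq_one_of_isometry hr0 h_norm⟩
  · rintro f rfl
    exact (h_left f).symm
  · rintro f _ rfl
    rw [← h_norm (dOp f - a • f), h_left]
  · intro f g
    ext i
    simp [coeff_dOpSubSMulInv, mul_add]
  · intro c f
    ext i
    simp [coeff_dOpSubSMulInv, mul_left_comm]
end
end

section
/- The classical spectrum of d in L_k(k((S))) is exactly the image of ℤ in k: for a ∈ k, the operator d − a·id fails to be invertible in L_k(k((S))) if and only if a = n·1_k for some integer n. -/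
noncomputable section
open scoped Classical

/-- `φ` is invertible in the algebra `L_k(k((S)))` of bounded `k`-linear operators:
it has a two-sided inverse which is `k`-linear and bounded. -/
def InvertibleOp {k : Type*} [Field k] (r : ℝ)
    (φ : LaurentSeries k → LaurentSeries k) : Prop :=
  ∃ ψ : LaurentSeries k → LaurentSeries k, IsLinearMap k ψ ∧
    (∃ C : ℝ, ∀ f, lnorm r (ψ f) ≤ C * lnorm r f) ∧
    (∀ f, ψ (φ f) = f) ∧ (∀ f, φ (ψ f) = f)

/-- The diagonal operator on `k((S))` multiplying the coefficient of `S ^ i` by `c i`. -/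
def diagOp {k : Type*} [Field k] (c : ℤ → k) (f : LaurentSeries k) : LaurentSeries k :=
  ⟨fun i => c i * f.coeff i,
    f.isPWO_support'.mono fun _ hi => right_ne_zero_of_mul hi⟩

@[simp]
theorem diagOp_coeff {k : Type*} [Field k] (c : ℤ → k) (f : LaurentSeries k) (i : ℤ) :
    (diagOp c f).coeff i = c i * f.coeff i := rfl

@[simp]
theorem dOp_coeff {k : Type*} [Field k] (f : LaurentSeries k) (i : ℤ) :
    (dOp f).coeff i = (i : k) * f.coeff i := rfl

theorem isLinearMap_diagOp {k : Type*} [Field k] (c : ℤ → k) : IsLinearMap k (diagOp c) where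
  map_add f g := by
    ext i
    simp [mul_add]
  map_smul b f := by
    ext i
    simp [mul_left_comm]

theorem lnorm_diagOp_le {k : Type*} [Field k] {r : ℝ} (hr0 : 0 < r) (hr1 : r ≤ 1)
    (c : ℤ → k) (f : LaurentSeries k) : lnorm r (diagOp c f) ≤ lnorm r f := by
  unfold lnorm
  split_ifs with hg hf hf
  · rfl
  · positivity
  · exact absurd (by ext i; simp [hf]) hg
  · refine zpow_le_zpow_right_of_le_one₀ hr0 hr1 (HahnSeries.order_le_of_coeff_ne_zero ?_)
    exact right_ne_zero_of_mul (a := c _) (HahnSeries.coeff_order_eq_zero.not.mpr hg)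

/-- the classical spectrum of `d = S·d/dS` in `L_k(k((S)))` is exactly the
image of `ℤ` in `k`: `d − a·id` fails to be invertible iff `a = n·1_k` for some `n ∈ ℤ`. -/
theorem classical_spectrum_dOp_eq_integers
    {k : Type*} [Field k] [CharZero k] (r : ℝ) (hr0 : 0 < r) (hr1 : r < 1) (a : k) :
    ¬ InvertibleOp r (fun f : LaurentSeries k => dOp f - a • f) ↔ ∃ n : ℤ, a = (n : k) := by
  constructor
  · intro h
    by_contra! hn
    have ha (i : ℤ) : (i : k) - a ≠ 0 := sub_ne_zero.mpr (hn i).symm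
    refine h ⟨diagOp fun i => ((i : k) - a)⁻¹, isLinearMap_diagOp _, ⟨1, fun f => ?_⟩,
      fun f => ?_, fun f => ?_⟩
    · rw [one_mul]
      exact lnorm_diagOp_le hr0 hr1.le _ f
    · ext i
      simp [← sub_mul, ha i]
    · ext i
      simp [← sub_mul, ha i]
  · rintro ⟨n, rfl⟩ ⟨ψ, hψ, -, hleft, -⟩
    have hker : dOp (HahnSeries.single n (1 : k)) - (n : k) • HahnSeries.single n (1 : k) = 0 := by
      ext i
      by_cases hi : i = n <;> simp [hi]
    have h := hleft (HahnSeries.single n 1)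
    simp only [hker, hψ.map_zero] at h
    exact HahnSeries.single_ne_zero one_ne_zero h.symm
end
end

section
/- Assume moreover that k is algebraically closed. Let G ∈ M_n(k) be a matrix with entries in k, with eigenvalues a_1, …, a_N ∈ k, and let ∇ be the bounded k-linear operator on the k-Banach space k((S))ⁿ (with the max norm) defined by ∇(v) = (d v_1, …, d v_n)ᵀ + G·v (a regular singular connection). Then the classical spectrum of ∇ in L_k(k((S))ⁿ) equals ⋃_{i=1}^{N} {a_i + m·1_k : m ∈ ℤ}. -/
noncomputable section
open scoped Classical

/-- The max norm on `k((S))ⁿ`. -/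
def vnorm {k : Type*} [Field k] (r : ℝ) {n : ℕ} (v : Fin n → LaurentSeries k) : ℝ :=
  sSup (Set.range fun i => lnorm r (v i))

/-- Invertibility in the algebra `L_k(k((S))ⁿ)` of bounded `k`-linear operators
(for the max norm on `k((S))ⁿ`). -/
def InvertibleOpV {k : Type*} [Field k] (r : ℝ) {n : ℕ}
    (φ : (Fin n → LaurentSeries k) → (Fin n → LaurentSeries k)) : Prop :=
  ∃ ψ : (Fin n → LaurentSeries k) → (Fin n → LaurentSeries k), IsLinearMap k ψ ∧
    (∃ C : ℝ, ∀ v, vnorm r (ψ v) ≤ C * vnorm r v) ∧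
    (∀ v, ψ (φ v) = v) ∧ (∀ v, φ (ψ v) = v)

/-- The coefficient of `S ^ m` of `(∇ - c) v` is `(G + (m - c)) v_m`. -/
lemma coeff_connection_sub_smul {k : Type*} [Field k] {n : ℕ} (G : Matrix (Fin n) (Fin n) k)
    (c : k) (v : Fin n → LaurentSeries k) (i : Fin n) (m : ℤ) :
    (dOp (v i) + (∑ j, G i j • v j) - c • v i).coeff m
      = ((G + ((m : k) - c) • (1 : Matrix (Fin n) (Fin n) k)).mulVec
          fun j => (v j).coeff m) i := by
  have hd : (dOp (v i)).coeff m = (m : k) * (v i).coeff m := rfl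
  rw [Matrix.add_mulVec, Matrix.smul_mulVec, Matrix.one_mulVec]
  simp only [HahnSeries.coeff_sub, HahnSeries.coeff_add, HahnSeries.coeff_sum,
    HahnSeries.coeff_smul, hd, Pi.add_apply, Pi.smul_apply, smul_eq_mul, Matrix.mulVec,
    dotProduct]
  ring

lemma lnorm_nonneg {k : Type*} [Field k] {r : ℝ} (hr : 0 < r) (f : LaurentSeries k) :
    0 ≤ lnorm r f := by
  unfold lnorm
  split_ifs
  exacts [le_rfl, (zpow_pos hr _).le]

lemma zpow_le_lnorm {k : Type*} [Field k] {r : ℝ} (hr0 : 0 < r) (hr1 : r < 1)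
    {f : LaurentSeries k} {m : ℤ} (hm : f.coeff m ≠ 0) : r ^ m ≤ lnorm r f := by
  have hf : f ≠ 0 := by
    rintro rfl
    exact hm rfl
  rw [lnorm, if_neg hf]
  exact zpow_le_zpow_right_of_le_one₀ hr0 hr1.le (HahnSeries.order_le_of_coeff_ne_zero hm)

lemma lnorm_le_vnorm {k : Type*} [Field k] (r : ℝ) {n : ℕ} (v : Fin n → LaurentSeries k)
    (i : Fin n) : lnorm r (v i) ≤ vnorm r v :=
  le_csSup (Set.finite_range _).bddAbove ⟨i, rfl⟩

lemma vnorm_nonneg {k : Type*} [Field k] {r : ℝ} (hr : 0 < r) {n : ℕ}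
    (v : Fin n → LaurentSeries k) : 0 ≤ vnorm r v :=
  Real.sSup_nonneg (by rintro _ ⟨i, rfl⟩; exact lnorm_nonneg hr _)

lemma exists_ne_zero_of_mulVec_ne_zero {k : Type*} [Field k] {n : ℕ}
    {B : Matrix (Fin n) (Fin n) k} {x : Fin n → k} {i : Fin n} (h : B.mulVec x i ≠ 0) :
    ∃ j, x j ≠ 0 :=
  Function.ne_iff.1 fun hx => h (hx ▸ congrFun (Matrix.mulVec_zero B) i)

/-- The operator on `k((S))ⁿ` acting on the coefficients of `S ^ m` through the matrix `B m`. -/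
def coeffwiseMulVec {k : Type*} [Field k] {n : ℕ} (B : ℤ → Matrix (Fin n) (Fin n) k)
    (v : Fin n → LaurentSeries k) : Fin n → LaurentSeries k := fun i =>
  ⟨fun m => ((B m).mulVec fun j => (v j).coeff m) i, by
    refine Set.IsPWO.mono
      ((Finset.isPWO_bUnion Finset.univ).2 fun j _ => (v j).isPWO_support) ?_
    intro m hm
    obtain ⟨j, hj⟩ := exists_ne_zero_of_mulVec_ne_zero hm
    exact Set.mem_biUnion (Finset.mem_univ j) hj⟩

lemma coeff_coeffwiseMulVec {k : Type*} [Field k] {n : ℕ} (B : ℤ → Matrix (Fin n) (Fin n) k)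
    (v : Fin n → LaurentSeries k) (i : Fin n) (m : ℤ) :
    (coeffwiseMulVec B v i).coeff m = ((B m).mulVec fun j => (v j).coeff m) i := rfl

lemma isLinearMap_coeffwiseMulVec {k : Type*} [Field k] {n : ℕ}
    (B : ℤ → Matrix (Fin n) (Fin n) k) : IsLinearMap k (coeffwiseMulVec B) where
  map_add v w := by
    ext i m
    simp only [Pi.add_apply, HahnSeries.coeff_add, coeff_coeffwiseMulVec]
    exact congrFun (Matrix.mulVec_add (B m) (fun j => (v j).coeff m) fun j => (w j).coeff m) i
  map_smul c v := by
    ext i m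
    simp only [Pi.smul_apply, HahnSeries.coeff_smul, coeff_coeffwiseMulVec]
    exact congrFun (Matrix.mulVec_smul (B m) c fun j => (v j).coeff m) i

lemma vnorm_coeffwiseMulVec_le {k : Type*} [Field k] {r : ℝ} (hr0 : 0 < r) (hr1 : r < 1) {n : ℕ}
    (B : ℤ → Matrix (Fin n) (Fin n) k) (v : Fin n → LaurentSeries k) :
    vnorm r (coeffwiseMulVec B v) ≤ vnorm r v := by
  refine Real.sSup_le ?_ (vnorm_nonneg hr0 v)
  rintro _ ⟨i, rfl⟩
  by_cases h0 : coeffwiseMulVec B v i = 0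
  · simpa only [lnorm, if_pos h0] using vnorm_nonneg hr0 v
  · obtain ⟨j, hj⟩ := exists_ne_zero_of_mulVec_ne_zero
      ((coeff_coeffwiseMulVec B v i _).symm.trans_ne (mt HahnSeries.coeff_order_eq_zero.1 h0))
    simp only [lnorm, if_neg h0]
    exact (zpow_le_lnorm hr0 hr1 hj).trans (lnorm_le_vnorm r v j)

lemma hasEigenvalue_toLin'_iff_det {k : Type*} [Field k] {n : ℕ}
    (G : Matrix (Fin n) (Fin n) k) (b : k) :
    Module.End.HasEigenvalue (Matrix.toLin' G) (-b) ↔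
      (G + b • (1 : Matrix (Fin n) (Fin n) k)).det = 0 := by
  have key (x : Fin n → k) :
      (G + b • (1 : Matrix (Fin n) (Fin n) k)).mulVec x = 0 ↔ Matrix.toLin' G x = -b • x := by
    rw [Matrix.add_mulVec, Matrix.smul_mulVec, Matrix.one_mulVec, Matrix.toLin'_apply,
      neg_smul, eq_neg_iff_add_eq_zero]
  rw [← Matrix.exists_mulVec_eq_zero_iff]
  constructor
  · intro h
    obtain ⟨x, hx⟩ := h.exists_hasEigenvector
    exact ⟨x, hx.2, (key x).2 hx.apply_eq_smul⟩
  · rintro ⟨x, hx, h⟩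
    exact Module.End.hasEigenvalue_of_hasEigenvector
      ⟨Module.End.mem_eigenspace_iff.2 ((key x).1 h), hx⟩

/-- `∇ - c` is invertible exactly when all the matrices `G + (m - c)`, `m ∈ ℤ`, are. -/
lemma invertibleOpV_connection_sub_smul_iff {k : Type*} [Field k] {r : ℝ} (hr0 : 0 < r)
    (hr1 : r < 1) {n : ℕ} (G : Matrix (Fin n) (Fin n) k) (c : k) :
    InvertibleOpV r (fun v : Fin n → LaurentSeries k =>
        fun i => dOp (v i) + (∑ j, G i j • v j) - c • v i) ↔
      ∀ m : ℤ, (G + ((m : k) - c) • (1 : Matrix (Fin n) (Fin n) k)).det ≠ 0 := by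
  constructor
  · rintro ⟨ψ, hψ, -, hl, -⟩ m hm
    obtain ⟨x, hx, h⟩ := Matrix.exists_mulVec_eq_zero_iff.2 hm
    refine hx ?_
    have hφ : (fun i => dOp (HahnSeries.single m (x i)) +
        (∑ j, G i j • HahnSeries.single m (x j)) - c • HahnSeries.single m (x i)) = 0 := by
      ext i l
      rw [coeff_connection_sub_smul G c (fun j => HahnSeries.single m (x j)) i l]
      by_cases hlm : l = m
      · subst hlm
        simp only [HahnSeries.coeff_single_same]
        exact congrFun h i
      · simp only [HahnSeries.coeff_single_of_ne hlm]
        exact congrFun (Matrix.mulVec_zero _) i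
    have h0 := hl fun j => HahnSeries.single m (x j)
    simp only [hφ, hψ.map_zero] at h0
    ext i
    simpa using (congrArg (fun f => HahnSeries.coeff f m) (congrFun h0 i)).symm
  · intro h
    refine ⟨coeffwiseMulVec fun m => (G + ((m : k) - c) • (1 : Matrix (Fin n) (Fin n) k))⁻¹,
      isLinearMap_coeffwiseMulVec _,
      ⟨1, fun v => (one_mul (vnorm r v)).symm ▸ vnorm_coeffwiseMulVec_le hr0 hr1 _ v⟩, ?_, ?_⟩
    · intro v
      ext i m
      simp only [coeff_coeffwiseMulVec, coeff_connection_sub_smul]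
      rw [Matrix.mulVec_mulVec, Matrix.nonsing_inv_mul _ (h m).isUnit, Matrix.one_mulVec]
    · intro v
      ext i m
      simp only [coeff_connection_sub_smul, coeff_coeffwiseMulVec]
      rw [Matrix.mulVec_mulVec, Matrix.mul_nonsing_inv _ (h m).isUnit, Matrix.one_mulVec]

/-- `k` algebraically closed, `G ∈ M_n(k)` with eigenvalues `a₁,…,a_N`,
and `∇ v = (d v₁, …, d vₙ)ᵀ + G·v` a regular singular connection on `k((S))ⁿ`.  The
classical spectrum of `∇` in `L_k(k((S))ⁿ)` equals `⋃ᵢ {aᵢ + m·1_k : m ∈ ℤ}`. -/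
theorem classical_spectrum_regular_singular_connection_explicit
    {k : Type*} [Field k] [CharZero k] [IsAlgClosed k]
    (r : ℝ) (hr0 : 0 < r) (hr1 : r < 1)
    (n N : ℕ) (G : Matrix (Fin n) (Fin n) k) (a : Fin N → k)
    (hEig : ∀ c : k, (∃ i, a i = c) ↔ Module.End.HasEigenvalue (Matrix.toLin' G) c) :
    {c : k | ¬ InvertibleOpV r (fun v : Fin n → LaurentSeries k =>
        fun i => dOp (v i) + (∑ j, G i j • v j) - c • v i)}
      = ⋃ i : Fin N, {c : k | ∃ m : ℤ, c = a i + (m : k)} := by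
  ext c
  rw [Set.mem_ofPred_eq, invertibleOpV_connection_sub_smul_iff hr0 hr1]
  simp only [ne_eq, not_forall, not_not, ← hasEigenvalue_toLin'_iff_det, ← hEig,
    Set.mem_iUnion, Set.mem_ofPred_eq, neg_sub]
  constructor
  · rintro ⟨m, i, h⟩
    exact ⟨i, m, by rw [h, sub_add_cancel]⟩
  · rintro ⟨i, m, h⟩
    exact ⟨m, i, by rw [h, add_sub_cancel_right]⟩
end
end

section
/- Let m ≥ 1 be an integer and equip k((Z)) with the absolute value |Σ_{i ≥ N} a_i Z^i| = r^{N/m} (a_N ≠ 0). Let d_Z be the bounded k-linear operator (1/m)·Z·d/dZ on k((Z)), i.e. d_Z(Σ a_i Z^i) = Σ (i/m)·a_i Z^i. Let f ∈ k((Z)) with |f| > 1 (equivalently, f has a pole, i.e. strictly negative Z-adic valuation), and let m_f denote multiplication by f. Then for every a ∈ k the operator d_Z + m_f − a·id is invertible in L_k(k((Z))) and its inverse has operator norm |f|^{−1}. In particular the classical spectrum of d_Z + m_f in L_k(k((Z))) is empty. -/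
noncomputable section
open scoped Classical

/-- The operator `d_Z = (1/m)·Z·d/dZ` on `k((Z))`: `d_Z (Σ aᵢ Zⁱ) = Σ (i/m)·aᵢ Zⁱ`. -/
def dZ {k : Type*} [Field k] (m : ℕ) (f : LaurentSeries k) : LaurentSeries k :=
  ⟨fun i => ((i : k) / (m : k)) * f.coeff i,
    f.isPWO_support'.mono fun i hi => by
      simp only [Function.mem_support, ne_eq] at hi ⊢
      intro h
      exact hi (by rw [h, mul_zero])⟩

/-- The absolute value on `k((Z))` given by `|Σ_{i ≥ N} aᵢ Zⁱ| = r^{N/m}` (`a_N ≠ 0`). -/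
def lnormZ {k : Type*} [Field k] (r : ℝ) (m : ℕ) (f : LaurentSeries k) : ℝ :=
  if f = 0 then 0 else r ^ ((f.order : ℝ) / (m : ℝ))

/-- The operator norm on `L_k(k((Z)))`. -/
def opNormZ {k : Type*} [Field k] (r : ℝ) (m : ℕ)
    (φ : LaurentSeries k → LaurentSeries k) : ℝ :=
  sSup {x : ℝ | ∃ f : LaurentSeries k, f ≠ 0 ∧ x = lnormZ r m (φ f) / lnormZ r m f}

theorem coeff_mul_eq_zero_of_lt {k : Type*} [Field k] {a b : ℤ} {f g : LaurentSeries k}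
    (hf : ∀ i < a, f.coeff i = 0) (hg : ∀ i < b, g.coeff i = 0) :
    ∀ i < a + b, (f * g).coeff i = 0 := by
  intro i hi
  by_cases hf0 : f = 0
  · simp [hf0]
  by_cases hg0 : g = 0
  · simp [hg0]
  apply HahnSeries.coeff_eq_zero_of_lt_order
  rw [HahnSeries.order_mul hf0 hg0]
  have h1 : a ≤ f.order := by
    by_contra! h
    exact (HahnSeries.coeff_order_eq_zero.not.mpr hf0) (hf _ h)
  have h2 : b ≤ g.order := by
    by_contra! h
    exact (HahnSeries.coeff_order_eq_zero.not.mpr hg0) (hg _ h)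
  omega

/-- A `k`-linear endomorphism of `k((Z))` that strictly raises valuations has a fixed point
after any translation. -/
theorem exists_eq_add_of_raises_valuation {k : Type*} [Field k]
    (D : LaurentSeries k →ₗ[k] LaurentSeries k)
    (hD : ∀ (n : ℤ) (g : LaurentSeries k), (∀ i < n, g.coeff i = 0) →
      ∀ i < n + 1, (D g).coeff i = 0) (x : LaurentSeries k) :
    ∃ g, g = x + D g := by
  set N := x.order with hN
  let S : ℕ → LaurentSeries k := fun j => (fun s => x + D s)^[j] 0
  have hS : ∀ j, S (j + 1) = x + D (S j) := fun j => Function.iterate_succ_apply' _ _ _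
  have hstep : ∀ j : ℕ, ∀ i < N + j, (S (j + 1) - S j).coeff i = 0 := by
    intro j
    induction j with
    | zero =>
      intro i hi
      have : S 0 = 0 := rfl
      rw [hS, this, map_zero, add_zero, sub_zero]
      exact HahnSeries.coeff_eq_zero_of_lt_order (by simpa using hi)
    | succ j ih =>
      intro i hi
      have : S (j + 1 + 1) - S (j + 1) = D (S (j + 1) - S j) := by
        rw [hS (j + 1), map_sub, hS j]; abel
      rw [this]
      exact hD _ _ ih i (by push_cast at hi; omega)
  have hstab : ∀ (j l : ℕ), ∀ i < N + j, (S (j + l)).coeff i = (S j).coeff i := by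
    intro j l i hi
    induction l with
    | zero => rfl
    | succ l ih =>
      have := hstep (j + l) i (by push_cast; omega)
      rw [HahnSeries.coeff_sub, sub_eq_zero] at this
      rw [← ih, ← this, add_assoc]
  let c : ℤ → k := fun i => (S ((i - N).toNat + 1)).coeff i
  have hc : ∀ (j : ℕ), ∀ i < N + j, c i = (S j).coeff i := by
    intro j i hi
    have h1 := hstab ((i - N).toNat + 1) j i (by push_cast; omega)
    have h2 := hstab j ((i - N).toNat + 1) i hi
    rw [← h2, add_comm j, h1]
  have hbdd : BddBelow (Function.support c) := by
    refine ⟨N, fun i hi => ?_⟩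
    by_contra! h
    exact hi (hc 0 i (by simpa using h))
  let g : LaurentSeries k := HahnSeries.ofSuppBddBelow c hbdd
  have hg : ∀ (j : ℕ), ∀ i < N + j, (g - S j).coeff i = 0 := by
    intro j i hi
    rw [HahnSeries.coeff_sub, sub_eq_zero]
    exact hc j i hi
  refine ⟨g, ?_⟩
  rw [← sub_eq_zero]
  ext i
  have hdec : g - (x + D g) =
      (g - S ((i - N).toNat + 1 + 1)) - D (g - S ((i - N).toNat + 1)) := by
    rw [hS ((i - N).toNat + 1), map_sub]; abel
  rw [hdec, HahnSeries.coeff_sub, hg _ i (by push_cast; omega),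
    hD _ _ (hg _) i (by push_cast; omega)]
  simp

theorem coeff_dZ {k : Type*} [Field k] (m : ℕ) (f : LaurentSeries k) (i : ℤ) :
    (dZ m f).coeff i = ((i : k) / (m : k)) * f.coeff i := rfl

/-- `dZ m` as a linear map. -/
def dZLinear (k : Type*) [Field k] (m : ℕ) : LaurentSeries k →ₗ[k] LaurentSeries k where
  toFun := dZ m
  map_add' f g := by ext i; simp [coeff_dZ, mul_add]
  map_smul' c f := by ext i; simp [coeff_dZ, mul_left_comm]

/-- Multiplication by `f` on `k((Z))` as a `k`-linear map. -/
def mulLinear {k : Type*} [Field k] (f : LaurentSeries k) :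
    LaurentSeries k →ₗ[k] LaurentSeries k where
  toFun g := f * g
  map_add' := mul_add f
  map_smul' c g := by
    simp only [← HahnSeries.C_mul_eq_smul, RingHom.id_apply, mul_left_comm]

/-- The operator `d_Z + m_f - a·id` as a linear map. -/
def dZAddMulSub {k : Type*} [Field k] (m : ℕ) (f : LaurentSeries k) (a : k) :
    LaurentSeries k →ₗ[k] LaurentSeries k :=
  dZLinear k m + mulLinear f - a • LinearMap.id

theorem dZAddMulSub_apply {k : Type*} [Field k] (m : ℕ) (f : LaurentSeries k) (a : k)
    (g : LaurentSeries k) : dZAddMulSub m f a g = dZ m g + f * g - a • g := rfl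

theorem dZAddMulSub_ne_zero_and_order {k : Type*} [Field k] (m : ℕ) {f : LaurentSeries k}
    (hf0 : f ≠ 0) (hf : f.order < 0) (a : k) {g : LaurentSeries k} (hg : g ≠ 0) :
    dZAddMulSub m f a g ≠ 0 ∧ (dZAddMulSub m f a g).order = f.order + g.order := by
  have hord := HahnSeries.order_mul hf0 hg
  have hcoeff : ∀ i < g.order, (dZAddMulSub m f a g).coeff i = (f * g).coeff i := by
    intro i hi
    simp [dZAddMulSub_apply, coeff_dZ, HahnSeries.coeff_eq_zero_of_lt_order hi]
  have hlead : (dZAddMulSub m f a g).coeff (f.order + g.order) ≠ 0 := by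
    rw [hcoeff _ (by omega), ← hord]
    exact HahnSeries.coeff_order_eq_zero.not.mpr (mul_ne_zero hf0 hg)
  have hne : dZAddMulSub m f a g ≠ 0 := fun h => hlead (by rw [h]; rfl)
  refine ⟨hne, le_antisymm (HahnSeries.order_le_of_coeff_ne_zero hlead) ?_⟩
  by_contra! h
  apply HahnSeries.coeff_order_eq_zero.not.mpr hne
  rw [hcoeff _ (by omega)]
  exact HahnSeries.coeff_eq_zero_of_lt_order (by rwa [hord])

theorem dZAddMulSub_bijective {k : Type*} [Field k] (m : ℕ) {f : LaurentSeries k}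
    (hf0 : f ≠ 0) (hf : f.order < 0) (a : k) : Function.Bijective (dZAddMulSub m f a) := by
  refine ⟨(injective_iff_map_eq_zero _).mpr fun g hg => ?_, fun h => ?_⟩
  · by_contra hg0
    exact (dZAddMulSub_ne_zero_and_order m hf0 hf a hg0).1 hg
  · have hinv : ∀ i < 1, (f⁻¹).coeff i = 0 := by
      intro i hi
      apply HahnSeries.coeff_eq_zero_of_lt_order
      have := HahnSeries.order_mul hf0 (inv_ne_zero hf0)
      rw [mul_inv_cancel₀ hf0, HahnSeries.order_one] at this
      omega
    obtain ⟨g, hg⟩ := exists_eq_add_of_raises_valuation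
      (mulLinear f⁻¹ ∘ₗ (a • LinearMap.id - dZLinear k m))
      (fun n g hg i hi => by
        refine coeff_mul_eq_zero_of_lt hinv (b := n) (fun l hl => ?_) i (by omega)
        change (a • g - dZ m g).coeff l = 0
        simp [coeff_dZ, hg l hl]) (f⁻¹ * h)
    refine ⟨g, ?_⟩
    change g = f⁻¹ * h + f⁻¹ * (a • g - dZ m g) at hg
    have hfg : f * g = h + (a • g - dZ m g) := by
      rw [← mul_add] at hg
      conv_lhs => rw [hg]
      rw [mul_inv_cancel_left₀ hf0]
    rw [dZAddMulSub_apply, hfg]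
    abel

theorem lnormZ_pos {k : Type*} [Field k] {r : ℝ} (hr : 0 < r) (m : ℕ) {g : LaurentSeries k}
    (hg : g ≠ 0) : 0 < lnormZ r m g := by
  rw [lnormZ, if_neg hg]
  exact Real.rpow_pos_of_pos hr _

theorem lnormZ_dZAddMulSub {k : Type*} [Field k] {r : ℝ} (hr : 0 < r) (m : ℕ)
    {f : LaurentSeries k} (hf0 : f ≠ 0) (hf : f.order < 0) (a : k) (g : LaurentSeries k) :
    lnormZ r m (dZAddMulSub m f a g) = lnormZ r m f * lnormZ r m g := by
  by_cases hg : g = 0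
  · simp [hg, lnormZ]
  obtain ⟨hne, hord⟩ := dZAddMulSub_ne_zero_and_order m hf0 hf a hg
  rw [lnormZ, if_neg hne, hord, lnormZ, if_neg hf0, lnormZ, if_neg hg, ← Real.rpow_add hr]
  push_cast
  rw [add_div]

/-- for `f ∈ k((Z))` with `|f| > 1` (equivalently `f` has strictly negative
`Z`-adic valuation), for every `a ∈ k` the operator `d_Z + m_f − a·id` is invertible in
`L_k(k((Z)))` with inverse of operator norm `|f|⁻¹`; in particular the classical spectrum
of `d_Z + m_f` is empty. -/
theorem dZ_add_mul_invertible_spectrum_empty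
    {k : Type*} [Field k] [CharZero k] (r : ℝ) (hr0 : 0 < r) (hr1 : r < 1)
    (m : ℕ) (hm : 1 ≤ m) (f : LaurentSeries k)
    (hf : f ≠ 0 ∧ f.order < 0) (hf' : 1 < lnormZ r m f) :
    (∀ a : k, ∃ ψ : LaurentSeries k → LaurentSeries k, IsLinearMap k ψ ∧
      (∃ C : ℝ, ∀ g, lnormZ r m (ψ g) ≤ C * lnormZ r m g) ∧
      (∀ g, ψ (dZ m g + f * g - a • g) = g) ∧
      (∀ g, dZ m (ψ g) + f * ψ g - a • ψ g = g) ∧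
      opNormZ r m ψ = (lnormZ r m f)⁻¹) ∧
    {a : k | ¬ ∃ ψ : LaurentSeries k → LaurentSeries k, IsLinearMap k ψ ∧
      (∃ C : ℝ, ∀ g, lnormZ r m (ψ g) ≤ C * lnormZ r m g) ∧
      (∀ g, ψ (dZ m g + f * g - a • g) = g) ∧
      (∀ g, dZ m (ψ g) + f * ψ g - a • ψ g = g)} = ∅ := by
  have key : ∀ a : k, ∃ ψ : LaurentSeries k → LaurentSeries k, IsLinearMap k ψ ∧
      (∃ C : ℝ, ∀ g, lnormZ r m (ψ g) ≤ C * lnormZ r m g) ∧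
      (∀ g, ψ (dZ m g + f * g - a • g) = g) ∧
      (∀ g, dZ m (ψ g) + f * ψ g - a • ψ g = g) ∧
      opNormZ r m ψ = (lnormZ r m f)⁻¹ := by
    intro a
    let e := LinearEquiv.ofBijective _ (dZAddMulSub_bijective m hf.1 hf.2 a)
    have hfpos : 0 < lnormZ r m f := lnormZ_pos hr0 m hf.1
    have hnorm : ∀ g, lnormZ r m (e.symm g) = (lnormZ r m f)⁻¹ * lnormZ r m g := by
      intro g
      have h := lnormZ_dZAddMulSub hr0 m hf.1 hf.2 a (e.symm g)
      have he : dZAddMulSub m f a (e.symm g) = g := e.apply_symm_apply g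
      rw [he] at h
      rw [h, inv_mul_cancel_left₀ hfpos.ne']
    refine ⟨e.symm, e.symm.toLinearMap.isLinear, ⟨_, fun g => (hnorm g).le⟩,
      e.symm_apply_apply, e.apply_symm_apply, ?_⟩
    have hset : {x : ℝ | ∃ g : LaurentSeries k, g ≠ 0 ∧
        x = lnormZ r m (e.symm g) / lnormZ r m g} = {(lnormZ r m f)⁻¹} := by
      have hquot : ∀ g : LaurentSeries k, g ≠ 0 →
          lnormZ r m (e.symm g) / lnormZ r m g = (lnormZ r m f)⁻¹ := fun g hg => by
        rw [hnorm, mul_div_cancel_right₀ _ (lnormZ_pos hr0 m hg).ne']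
      ext x
      constructor
      · rintro ⟨g, hg, rfl⟩
        exact hquot g hg
      · rintro rfl
        exact ⟨1, one_ne_zero, (hquot 1 one_ne_zero).symm⟩
    rw [opNormZ, hset, csSup_singleton]
  refine ⟨key, Set.eq_empty_of_forall_notMem fun a ha => ha ?_⟩
  obtain ⟨ψ, hlin, hbdd, hleft, hright, -⟩ := key a
  exact ⟨ψ, hlin, hbdd, hleft, hright⟩
end
end

section
/- Let M₁ and M₂ be k-Banach spaces and M = M₁ × M₂ with the max norm. Let p₁, p₂ be the projections and i₁, i₂ the inclusions, let φ ∈ L_k(M), and set φ₁ = p₁∘φ∘i₁ ∈ L_k(M₁) and φ₂ = p₂∘φ∘i₂ ∈ L_k(M₂). Assume φ(M₁ × {0}) ⊆ M₁ × {0}. If Σ(φ₁) ∩ Σ(φ₂) = ∅, then Σ(φ) = Σ(φ₁) ∪ Σ(φ₂), where Σ(ψ) denotes the classical spectrum. -/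
noncomputable section

/-- The classical spectrum of a (bounded, linear) operator `φ` on a `k`-Banach space
`V`: the set of `a ∈ k` such that `φ − a·id` has no two-sided inverse in the algebra
`L_k(V)` of bounded `k`-linear operators. -/
def classicalSpectrum (k : Type*) [NormedField k] {V : Type*}
    [NormedAddCommGroup V] [Module k V] (φ : V → V) : Set k :=
  {a : k | ¬ ∃ ψ : V → V, IsLinearMap k ψ ∧ (∃ C : ℝ, ∀ v, ‖ψ v‖ ≤ C * ‖v‖) ∧
    (∀ v, ψ (φ v - a • v) = v) ∧ (∀ v, φ (ψ v) - a • ψ v = v)}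

/-- `T` has a two-sided inverse that is a bounded linear map. When the norm of `k` is trivial this
is stronger than having a continuous linear inverse. -/
def HasBoundedInverse (k : Type*) [NormedField k] {V : Type*} [NormedAddCommGroup V] [Module k V]
    (T : V → V) : Prop :=
  ∃ S : V → V, IsBoundedLinearMap k S ∧ (∀ v, S (T v) = v) ∧ ∀ v, T (S v) = v

theorem notMem_classicalSpectrum_iff {k V : Type*} [NormedField k] [NormedAddCommGroup V]
    [Module k V] {φ : V → V} {a : k} :
    a ∉ classicalSpectrum k φ ↔ HasBoundedInverse k (fun v => φ v - a • v) := by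
  refine not_not.trans ⟨?_, ?_⟩
  · rintro ⟨ψ, hψ, ⟨C, hC⟩, h⟩
    exact ⟨ψ, hψ.with_bound C hC, h⟩
  · rintro ⟨ψ, ⟨hψ, C, -, hC⟩, h⟩
    exact ⟨ψ, hψ, ⟨C, hC⟩, h⟩

section BlockTriangular

variable {k M₁ M₂ : Type*} [NormedField k] [NormedAddCommGroup M₁] [Module k M₁]
  [NormedAddCommGroup M₂] [Module k M₂] {T : M₁ × M₂ → M₁ × M₂}

theorem IsBoundedLinearMap.inl : IsBoundedLinearMap k fun x : M₁ => (x, (0 : M₂)) :=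
  (LinearMap.inl k M₁ M₂).isLinear.with_bound 1 <| by simp

theorem IsBoundedLinearMap.inr : IsBoundedLinearMap k fun y : M₂ => ((0 : M₁), y) :=
  (LinearMap.inr k M₁ M₂).isLinear.with_bound 1 <| by simp

theorem IsLinearMap.apply_mk (hT : IsLinearMap k T) (x : M₁) (y : M₂) :
    T (x, y) = T (x, 0) + T (0, y) := by
  rw [← hT.map_add]; simp

theorem blockTriangular_apply (hT : IsLinearMap k T) (h₀ : ∀ x, (T (x, 0)).2 = 0)
    (x : M₁) (y : M₂) : T (x, y) = ((T (x, 0)).1 + (T (0, y)).1, (T (0, y)).2) := by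
  rw [hT.apply_mk]
  ext <;> simp [h₀]

/-- A block triangular operator whose diagonal blocks `A`, `D` are invertible has the inverse
`(A⁻¹, -A⁻¹BD⁻¹; 0, D⁻¹)`. -/
theorem hasBoundedInverse_of_diagonal (hT : IsBoundedLinearMap k T)
    (h₀ : ∀ x, (T (x, 0)).2 = 0)
    (h₁ : HasBoundedInverse k fun x => (T (x, 0)).1)
    (h₂ : HasBoundedInverse k fun y => (T (0, y)).2) : HasBoundedInverse k T := by
  obtain ⟨P, hP, hPl, hPr⟩ := h₁
  obtain ⟨S, hS, hSl, hSr⟩ := h₂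
  have hSsnd : IsBoundedLinearMap k fun v : M₁ × M₂ => S v.2 := hS.comp .snd
  have hB : IsBoundedLinearMap k fun v : M₁ × M₂ => (T (0, S v.2)).1 :=
    IsBoundedLinearMap.fst.comp (hT.comp (IsBoundedLinearMap.inr.comp hSsnd))
  have hinv : IsBoundedLinearMap k
      fun v : M₁ × M₂ => (P (v.1 - (T (0, S v.2)).1), (0 : M₂)) + ((0 : M₁), S v.2) :=
    (IsBoundedLinearMap.inl.comp (hP.comp (IsBoundedLinearMap.fst.sub hB))).add
      (IsBoundedLinearMap.inr.comp hSsnd)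
  simp only [Prod.mk_add_mk, add_zero, zero_add] at hinv
  refine ⟨_, hinv, fun ⟨x, y⟩ => ?_, fun ⟨x, y⟩ => ?_⟩
  · rw [blockTriangular_apply hT.toIsLinearMap h₀ x y]
    simp only [hSl, add_sub_cancel_right, hPl]
  · rw [blockTriangular_apply hT.toIsLinearMap h₀]
    simp only [hPr, hSr, sub_add_cancel]

theorem diagonal_hasBoundedInverse (hT : IsLinearMap k T) (h₀ : ∀ x, (T (x, 0)).2 = 0)
    (h : HasBoundedInverse k T)
    (h' : HasBoundedInverse k (fun x => (T (x, 0)).1) ∨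
      HasBoundedInverse k fun y => (T (0, y)).2) :
    HasBoundedInverse k (fun x => (T (x, 0)).1) ∧
      HasBoundedInverse k fun y => (T (0, y)).2 := by
  obtain ⟨U, hU, hUl, hUr⟩ := h
  have hTx x : T (x, 0) = ((T (x, 0)).1, 0) := Prod.ext rfl (h₀ x)
  have hDU v : (T (0, (U v).2)).2 = v.2 := by
    conv_rhs => rw [← hUr v, ← Prod.mk.eta (p := U v), blockTriangular_apply hT h₀]
  have hU₀ x : (U (x, 0)).2 = 0 := by
    rcases h' with ⟨P, -, -, hPr⟩ | ⟨S, hS, hSl, -⟩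
    · have := hUl (P x, 0)
      beta_reduce at hPr
      rw [hTx, hPr] at this
      rw [this]
    · beta_reduce at hSl
      rw [← hSl (U (x, 0)).2, hDU, hS.map_zero]
  have hUx x : U (x, 0) = ((U (x, 0)).1, 0) := Prod.ext rfl (hU₀ x)
  refine ⟨⟨fun x => (U (x, 0)).1, IsBoundedLinearMap.fst.comp (hU.comp .inl), fun x => ?_,
    fun x => ?_⟩, ⟨fun y => (U (0, y)).2, IsBoundedLinearMap.snd.comp (hU.comp .inr),
    fun y => ?_, fun y => hDU (0, y)⟩⟩
  · beta_reduce
    rw [← hTx, hUl]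
  · beta_reduce
    rw [← hUx, hUr]
  · have h := congrArg Prod.snd (hU.apply_mk (T (0, y)).1 (T (0, y)).2)
    rw [Prod.mk.eta, hUl, Prod.snd_add, hU₀, zero_add] at h
    exact h.symm

end BlockTriangular

/-- `M = M₁ × M₂` with the max norm, `φ ∈ L_k(M)`,
`φ₁ = p₁∘φ∘i₁`, `φ₂ = p₂∘φ∘i₂`, with `φ(M₁ × {0}) ⊆ M₁ × {0}`.
If `Σ(φ₁) ∩ Σ(φ₂) = ∅`, then `Σ(φ) = Σ(φ₁) ∪ Σ(φ₂)`. -/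
theorem spectrum_block_triangular_disjoint
    {k : Type*} [NormedField k] [CompleteSpace k]
    {M₁ M₂ : Type*} [NormedAddCommGroup M₁] [NormedSpace k M₁] [CompleteSpace M₁]
    [NormedAddCommGroup M₂] [NormedSpace k M₂] [CompleteSpace M₂]
    (φ : M₁ × M₂ → M₁ × M₂) (hlin : IsLinearMap k φ)
    (hbdd : ∃ C : ℝ, ∀ v, ‖φ v‖ ≤ C * ‖v‖)
    (hstab : ∀ x : M₁, (φ (x, 0)).2 = 0)
    (hdisj : classicalSpectrum k (fun x : M₁ => (φ (x, 0)).1)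
        ∩ classicalSpectrum k (fun y : M₂ => (φ (0, y)).2) = ∅) :
    classicalSpectrum k φ
      = classicalSpectrum k (fun x : M₁ => (φ (x, 0)).1)
          ∪ classicalSpectrum k (fun y : M₂ => (φ (0, y)).2) := by
  obtain ⟨C, hC⟩ := hbdd
  ext a
  have hT : IsBoundedLinearMap k fun v => φ v - a • v :=
    (hlin.with_bound C hC).sub (IsBoundedLinearMap.id.smul a)
  have h₀ x : (φ (x, 0) - a • ((x, 0) : M₁ × M₂)).2 = 0 := by simp [hstab]
  have ha := hdisj ▸ Set.notMem_empty a
  rw [Set.mem_inter_iff, not_and_or, notMem_classicalSpectrum_iff,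
    notMem_classicalSpectrum_iff] at ha
  rw [← not_iff_not, Set.mem_union, not_or, notMem_classicalSpectrum_iff,
    notMem_classicalSpectrum_iff, notMem_classicalSpectrum_iff]
  exact ⟨fun h => diagonal_hasBoundedInverse hT.toIsLinearMap h₀ h ha,
    fun h => hasBoundedInverse_of_diagonal hT h₀ h.1 h.2⟩
end
end

section
/- (Cyclic vector theorem) Let F be a field of characteristic 0 and d : F → F an additive map satisfying d(ab) = a·d(b) + b·d(a) for all a, b ∈ F, with d ≠ 0. Let M be an F-vector space of finite dimension n together with an additive map ∇ : M → M satisfying ∇(f·m) = d(f)·m + f·∇(m) for all f ∈ F, m ∈ M. Then there exists m ∈ M such that (m, ∇(m), ∇²(m), …, ∇^{n−1}(m)) is an F-basis of M. -/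
/-- A perturbation `a + t • b` of a finite linearly independent family `a` stays linearly
independent for all `t` outside the roots of some nonzero polynomial. -/
theorem LinearIndependent.exists_polynomial_add_smul {F M ι : Type*} [Field F] [AddCommGroup M]
    [Module F M] [Finite ι] {a : ι → M} (ha : LinearIndependent F a) (b : ι → M) :
    ∃ q : Polynomial F, q ≠ 0 ∧
      ∀ t : F, q.eval t ≠ 0 → LinearIndependent F (fun i => a i + t • b i) := by
  classical
  cases nonempty_fintype ι
  obtain ⟨f, hf⟩ := ha.repr.exists_extend
  have hfa : ∀ i, f (a i) = Finsupp.single i 1 := fun i => by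
    have h := LinearMap.congr_fun hf ⟨a i, Submodule.subset_span ⟨i, rfl⟩⟩
    exact h.trans (ha.repr_eq_single i _ rfl)
  let B : Matrix ι ι F := Matrix.of fun i j => f (b i) j
  let Q : Matrix ι ι (Polynomial F) := 1 + (Polynomial.X : Polynomial F) • B.map Polynomial.C
  have hQ : ∀ t : F, Q.det.eval t = (1 + t • B).det := fun t => by
    rw [← Polynomial.coe_evalRingHom, RingHom.map_det]
    congr 1
    ext i j
    by_cases h : i = j <;> simp [Q, h, mul_comm t]
  refine ⟨Q.det, fun h => ?_, fun t ht => ?_⟩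
  · have h0 := hQ 0
    simp [h] at h0
  · rw [hQ] at ht
    have hrows := Matrix.linearIndependent_rows_of_det_ne_zero ht
    refine LinearIndependent.of_comp
      ((Finsupp.linearEquivFunOnFinite F F ι).toLinearMap ∘ₗ f) ?_
    have hcomp : ((Finsupp.linearEquivFunOnFinite F F ι).toLinearMap ∘ₗ f) ∘
        (fun i => a i + t • b i) = (1 + t • B).row := by
      ext i j
      simp [hfa, B, Matrix.row, Matrix.one_apply, Finsupp.single_apply]
    rw [hcomp]
    exact hrows

/-- A nonzero polynomial over a field of characteristic zero does not vanish at some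
element `l * c` with `l` a positive natural number. -/
theorem Polynomial.exists_nat_mul_eval_ne_zero {F : Type*} [Field F] [CharZero F]
    {q : Polynomial F} (hq : q ≠ 0) {c : F} (hc : c ≠ 0) :
    ∃ l : ℕ, l ≠ 0 ∧ q.eval (l * c) ≠ 0 := by
  by_contra! h
  refine hq (Polynomial.eq_zero_of_infinite_isRoot q ?_)
  refine (Set.infinite_range_of_injective (f := fun l : ℕ => ((l + 1 : ℕ) : F) * c) ?_).mono ?_
  · intro x y hxy
    simpa [hc] using hxy
  · rintro _ ⟨l, rfl⟩
    exact h (l + 1) l.succ_ne_zero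

section DifferentialModule

variable {F M : Type*} [Field F] [AddCommGroup M] [Module F M]

/-- The value of a linear form on `(D + s)^i x` is a polynomial in `s`, with coefficient `φ x`
in degree `i`. -/
theorem exists_polynomial_iterate_add_nsmul (D : M →+ M) (φ : M →ₗ[F] F) (i : ℕ) (x : M) :
    ∃ p : Polynomial F, p.degree < i ∧
      ∀ s : ℕ, φ ((fun y => D y + s • y)^[i] x) = (s : F) ^ i * φ x + p.eval (s : F) := by
  induction i generalizing x with
  | zero => exact ⟨0, by simp, by simp⟩
  | succ i ih =>
    obtain ⟨p, hp, hpe⟩ := ih x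
    obtain ⟨q, hq, hqe⟩ := ih (D x)
    refine ⟨Polynomial.C (φ (D x)) * Polynomial.X ^ i + q + Polynomial.X * p, ?_, fun s => ?_⟩
    · have hi : (i : WithBot ℕ) < ((i + 1 : ℕ) : WithBot ℕ) := by exact_mod_cast i.lt_succ_self
      refine (Polynomial.degree_add_le _ _).trans_lt (max_lt
        ((Polynomial.degree_add_le _ _).trans_lt (max_lt ?_ (hq.trans hi))) ?_)
      · exact (Polynomial.degree_C_mul_X_pow_le _ _).trans_lt hi
      · rcases eq_or_ne p 0 with rfl | hp0
        · simp
        · rw [Polynomial.degree_eq_natDegree (mul_ne_zero Polynomial.X_ne_zero hp0),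
            Polynomial.natDegree_X_mul hp0]
          rw [Polynomial.degree_eq_natDegree hp0] at hp
          have : p.natDegree < i := by exact_mod_cast hp
          exact_mod_cast Nat.succ_lt_succ this
    · let E : M →+ M := D + s • AddMonoidHom.id M
      have hE : (fun y => D y + s • y) = E := rfl
      have h := hqe s
      have h' := hpe s
      rw [hE] at h h' ⊢
      rw [Function.iterate_succ_apply]
      have hEx : E x = D x + s • x := rfl
      rw [hEx, iterate_map_add, iterate_map_nsmul, map_add, map_nsmul, h, h']
      simp
      ring

variable [CharZero F]

/-- If some vector has its first `k < dim M` iterates under `D` linearly independent, then some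
vector has its first `k + 1` iterates linearly independent. Here `D` lies over a derivation `δ`
with `δ z = z`. -/
theorem exists_linearIndependent_iterate_succ (δ : F → F) (D : M →+ M)
    (hleib : ∀ (f : F) (x : M), D (f • x) = δ f • x + f • D x)
    {z : F} (hz : z ≠ 0) (hδ : ∀ l s : ℕ, δ (l * z ^ s) = s * (l * z ^ s))
    {k : ℕ} (hk : k < Module.finrank F M) {m : M}
    (hm : LinearIndependent F (fun i : Fin k => D^[(i : ℕ)] m)) :
    ∃ x : M, LinearIndependent F (fun i : Fin (k + 1) => D^[(i : ℕ)] x) := by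
  set V := Submodule.span F (Set.range fun i : Fin k => D^[(i : ℕ)] m) with hV
  by_cases hmem : D^[k] m ∈ V
  swap
  · exact ⟨m, linearIndependent_finSucc'.2 ⟨hm, hmem⟩⟩
  obtain ⟨c, hc⟩ := (Submodule.mem_span_range_iff_exists_fun F).1 hmem
  have hVtop : V < ⊤ := lt_top_iff_ne_top.2 fun h => by
    have := finrank_span_eq_card hm
    rw [← hV, h, finrank_top, Fintype.card_fin] at this
    omega
  obtain ⟨m', -, hm'⟩ := SetLike.exists_of_lt hVtop
  obtain ⟨φ, hφm', hφV⟩ := Submodule.exists_le_ker_of_notMem hm'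
  let E : ℕ → M → M := fun s y => D y + s • y
  let w : ℕ → M := fun s => (E s)^[k] m' - ∑ i : Fin k, c i • (E s)^[(i : ℕ)] m'
  obtain ⟨s, hs⟩ : ∃ s : ℕ, φ (w s) ≠ 0 := by
    choose p hp hpe using fun i => exists_polynomial_iterate_add_nsmul D φ i m'
    let r : ℕ → Polynomial F := fun i => Polynomial.C (φ m') * Polynomial.X ^ i + p i
    have hr : ∀ i s, φ ((E s)^[i] m') = (r i).eval (s : F) := fun i s => by
      exact (hpe i s).trans (by simp [r]; ring)
    let q : Polynomial F := r k - ∑ i : Fin k, Polynomial.C (c i) * r i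
    have hq : q ≠ 0 := fun h => by
      have hcoeff : ∀ i : Fin k, (r i).coeff k = 0 := fun i => by
        have hik : ((i : ℕ) : WithBot ℕ) < (k : ℕ) := by exact_mod_cast i.2
        simp [r, Polynomial.coeff_X_pow, i.2.ne',
          Polynomial.coeff_eq_zero_of_degree_lt ((hp i).trans hik)]
      have := congrArg (fun q => Polynomial.coeff q k) h
      simp only [q, Polynomial.coeff_sub, Polynomial.finsetSum_coeff, Polynomial.coeff_C_mul,
        hcoeff] at this
      simp [r, Polynomial.coeff_eq_zero_of_degree_lt (hp k), hφm'] at this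
    obtain ⟨s, -, hs⟩ := Polynomial.exists_nat_mul_eval_ne_zero hq one_ne_zero
    refine ⟨s, ?_⟩
    rw [mul_one] at hs
    simpa [w, q, hr, Polynomial.eval_finsetSum] using hs
  have hli : LinearIndependent F (Fin.snoc (fun i : Fin k => D^[(i : ℕ)] m) (w s) :
      Fin (k + 1) → M) :=
    linearIndependent_finSnoc.2 ⟨hm, fun h => hs (hφV h)⟩
  obtain ⟨q, hq, hqt⟩ := hli.exists_polynomial_add_smul
    (Fin.snoc (fun i : Fin k => (E s)^[(i : ℕ)] m') 0 : Fin (k + 1) → M)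
  obtain ⟨l, hl, hlq⟩ := Polynomial.exists_nat_mul_eval_ne_zero hq (pow_ne_zero s hz)
  have hδt := hδ l s
  have ht0 : (l : F) * z ^ s ≠ 0 := mul_ne_zero (Nat.cast_ne_zero.2 hl) (pow_ne_zero s hz)
  specialize hqt _ hlq
  set t := (l : F) * z ^ s
  have hiter : ∀ i, D^[i] (m + t • m') = D^[i] m + t • (E s)^[i] m' := fun i => by
    induction i with
    | zero => rfl
    | succ i ih =>
      simp only [Function.iterate_succ_apply', ih, map_add, hleib, hδt, E]
      rw [smul_add, ← Nat.cast_smul_eq_nsmul F, smul_smul, mul_comm t (s : F)]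
      abel
  obtain ⟨hinit, hlast⟩ := linearIndependent_finSucc'.1 hqt
  simp only [Fin.init_def, Fin.snoc_castSucc, Fin.snoc_last, smul_zero, add_zero, ← hiter]
    at hinit hlast
  refine ⟨m + t • m', linearIndependent_finSucc'.2 ⟨hinit, fun h => hlast ?_⟩⟩
  change D^[k] (m + t • m') ∈
    Submodule.span F (Set.range fun i : Fin k => D^[(i : ℕ)] (m + t • m')) at h
  have hw : t • w s = D^[k] (m + t • m') - ∑ i : Fin k, c i • D^[(i : ℕ)] (m + t • m') := by
    simp only [hiter, w, smul_add, Finset.sum_add_distrib, hc, smul_sub, Finset.smul_sum,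
      smul_comm t]
    abel
  refine (Submodule.smul_mem_iff _ ht0).1 (hw ▸ Submodule.sub_mem _ h ?_)
  exact Submodule.sum_mem _ fun i _ =>
    Submodule.smul_mem _ _ (Submodule.subset_span ⟨i, rfl⟩)

end DifferentialModule

/-- Iterates of `g • ∇` lie in the span of the iterates of `∇`. -/
theorem iterate_smul_mem_span {F M : Type*} [Field F] [AddCommGroup M] [Module F M]
    (d : F → F) (nab : M →+ M) (hleib : ∀ (f : F) (x : M), nab (f • x) = d f • x + f • nab x)
    (g : F) (m : M) (i : ℕ) :
    (fun x => g • nab x)^[i] m ∈ Submodule.span F ((fun j => nab^[j] m) '' Set.Iic i) := by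
  induction i with
  | zero => exact Submodule.subset_span ⟨0, by simp, rfl⟩
  | succ i ih =>
    rw [Function.iterate_succ_apply']
    refine Submodule.smul_mem _ _ ?_
    generalize (fun x => g • nab x)^[i] m = y at ih ⊢
    induction ih using Submodule.span_induction with
    | mem x hx =>
      obtain ⟨j, hj, rfl⟩ := hx
      exact Submodule.subset_span
        ⟨j + 1, Nat.succ_le_succ hj, Function.iterate_succ_apply' _ _ _⟩
    | zero => simp
    | add x y _ _ hx hy => exact map_add nab x y ▸ Submodule.add_mem _ hx hy
    | smul a x hx hnx =>
      rw [hleib]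
      refine Submodule.add_mem _ (Submodule.smul_mem _ _ ?_) (Submodule.smul_mem _ _ hnx)
      exact Submodule.span_mono (Set.image_mono (Set.Iic_subset_Iic.2 i.le_succ)) hx

/-- Cyclic vector theorem: let `F` be a field of characteristic `0` with
a nonzero derivation `d`, and `(M, ∇)` a differential module over `(F, d)` of finite
dimension `n`.  Then there is `m ∈ M` such that `(m, ∇ m, …, ∇^{n−1} m)` is an
`F`-basis of `M`. -/
theorem cyclic_vector_theorem
    {F : Type*} [Field F] [CharZero F]
    (d : F → F) (hd_add : ∀ a b : F, d (a + b) = d a + d b)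
    (hd_mul : ∀ a b : F, d (a * b) = a * d b + b * d a)
    (hd_ne : d ≠ 0)
    {M : Type*} [AddCommGroup M] [Module F M] [FiniteDimensional F M]
    (nab : M → M) (hnab_add : ∀ x y : M, nab (x + y) = nab x + nab y)
    (hleib : ∀ (f : F) (x : M), nab (f • x) = d f • x + f • nab x) :
    ∃ m : M,
      LinearIndependent F (fun i : Fin (Module.finrank F M) => nab^[(i : ℕ)] m) ∧
      Submodule.span F (Set.range fun i : Fin (Module.finrank F M) => nab^[(i : ℕ)] m)
        = ⊤ := by
  obtain ⟨z, hdz⟩ := Function.ne_iff.1 hd_ne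
  rw [Pi.zero_apply] at hdz
  let d' : Derivation ℕ F F := Derivation.mk' (AddMonoidHom.mk' d hd_add).toNatLinearMap hd_mul
  have hd' : ∀ a, d a = d' a := fun _ => rfl
  have hz : z ≠ 0 := by
    rintro rfl
    exact hdz (map_zero d')
  let g := z / d z
  let N : M →+ M := AddMonoidHom.mk' nab hnab_add
  let D : M →+ M := (DistribSMul.toAddMonoidHom M g).comp N
  have hDleib : ∀ (f : F) (x : M), D (f • x) = (g * d f) • x + f • D x := fun f x => by
    change g • nab (f • x) = _ + f • g • nab x
    rw [hleib, smul_add, smul_smul, smul_comm]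
  have hδ : ∀ l s : ℕ, g * d (l * z ^ s) = s * (l * z ^ s) := fun l s => by
    rw [hd_mul, hd' (z ^ s), hd' l, Derivation.map_natCast, Derivation.leibniz_pow, ← hd']
    cases s with
    | zero => simp
    | succ s =>
      simp only [g, smul_eq_mul, nsmul_eq_mul, Nat.add_sub_cancel]
      field_simp
      ring
  have hex : ∀ k ≤ Module.finrank F M,
      ∃ m : M, LinearIndependent F (fun i : Fin k => D^[(i : ℕ)] m) := fun k => by
    induction k with
    | zero => exact fun _ => ⟨0, linearIndependent_empty_type⟩
    | succ k ih =>
      intro hk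
      obtain ⟨m, hm⟩ := ih (Nat.le_of_succ_le hk)
      exact exists_linearIndependent_iterate_succ _ D hDleib hz hδ hk hm
  obtain ⟨m, hm⟩ := hex _ le_rfl
  have htop : ⊤ ≤ Submodule.span F
      (Set.range fun i : Fin (Module.finrank F M) => nab^[(i : ℕ)] m) := by
    rw [← hm.span_eq_top_of_card_eq_finrank' (Fintype.card_fin _), Submodule.span_le]
    rintro _ ⟨i, rfl⟩
    refine Submodule.span_mono ?_ (iterate_smul_mem_span d N hleib g m i)
    rintro _ ⟨j, hj, rfl⟩
    exact ⟨⟨j, hj.trans_lt i.2⟩, rfl⟩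
  exact ⟨m, linearIndependent_of_top_le_span_of_card_eq_finrank htop (Fintype.card_fin _),
    top_le_iff.1 htop⟩
end
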